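/- The composite map γ^{−1} ∘ ξ ∘ γ is a bijection from Nor_n to itself such that λ^{Comb}(γ^{−1}ξγ(Υ)) = λ^{Lyn}(Υ) for every Υ ∈ Nor_n; moreover this bijection preserves the left-to-right sequence of leaf labels of each tree. -/

import Mathlib

/-! Colored labeled binary trees.  Leaf labels are positive integers; colors are
natural numbers (the paper's color set ℙ = {1,2,…} is identified with ℕ via j ↦ j-1,
i.e. color index `i : ℕ` represents the paper's color `i+1`). -/

inductive CTree : Type
  | leaf (label : ℕ) : CTree
  | node (color : ℕ) (l r : CTree) : CTree
deriving DecidableEq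

namespace CTree

/-- leaf labels from left to right -/
def leavesList : CTree → List ℕ
  | leaf m => [m]
  | node _ l r => leavesList l ++ leavesList r

/-- the valency `v(x)`: smallest leaf label of the subtree -/
def minLeaf : CTree → ℕ
  | leaf m => m
  | node _ l r => min (minLeaf l) (minLeaf r)

/-- a tree is normalized if in every subtree the leftmost leaf carries the
smallest leaf label of the subtree. -/
def Normalized : CTree → Prop
  | leaf _ => True
  | node _ l r => Normalized l ∧ Normalized r ∧ minLeaf l < minLeaf r

/-- number of internal nodes with color `j` -/
def colorCount : CTree → ℕ → ℕ
  | leaf _, _ => 0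
  | node c l r, j => (if c = j then 1 else 0) + colorCount l j + colorCount r j

def isLeafB : CTree → Bool
  | leaf _ => true
  | node _ _ _ => false

def left : CTree → CTree
  | leaf m => leaf m
  | node _ l _ => l

def right : CTree → CTree
  | leaf m => leaf m
  | node _ _ r => r

def rootColor : CTree → ℕ
  | leaf _ => 0
  | node c _ _ => c

/-- the root of `T` is a Lyndon node: either the left child is a leaf
or `v(R(L(x))) > v(R(x))`. (Leaves count as Lyndon.) -/
def RootLyndonB (T : CTree) : Bool :=
  isLeafB T || isLeafB (left T) || decide (minLeaf (right T) < minLeaf (right (left T)))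

/-- colored Lyndon condition: every internal node that is not a Lyndon node
satisfies `color(L(x)) > color(x)` -/
def LynColored : CTree → Prop
  | leaf _ => True
  | node c l r => LynColored l ∧ LynColored r ∧
      (RootLyndonB (node c l r) = true ∨ c < rootColor l)

/-- colored comb condition: every internal node whose right child is internal
satisfies `color(x) > color(R(x))` -/
def CombColored : CTree → Prop
  | leaf _ => True
  | node c l r => CombColored l ∧ CombColored r ∧ (isLeafB r = true ∨ rootColor r < c)

/-- all colors equal to `0`: an (essentially) uncolored tree. -/
def Mono : CTree → Prop
  | leaf _ => True
  | node c l r => c = 0 ∧ Mono l ∧ Mono r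

/-- the tree has leaf label set `[n] = {1,…,n}` (each label once) -/
def OnSet (n : ℕ) (T : CTree) : Prop := T.leavesList.Perm ((List.range n).map (· + 1))

/-- `lynAux T = (b, m)`: `b` is the size of the block of `π^{Lyn}` containing the
root (`0` for a leaf) and `m` is the multiset of sizes of the other blocks. -/
def lynAux : CTree → ℕ × Multiset ℕ
  | leaf _ => (0, 0)
  | node c l r =>
    let bl := (lynAux l).1
    let ml := (lynAux l).2
    let br := (lynAux r).1
    let mr := (lynAux r).2
    let closedR := mr + (if br = 0 then 0 else {br})
    if RootLyndonB (node c l r) then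
      (1, ml + (if bl = 0 then 0 else {bl}) + closedR)
    else (1 + bl, ml + closedR)

/-- the Lyndon type `λ^{Lyn}`: multiset of block sizes of `π^{Lyn}` -/
def lynType (T : CTree) : Multiset ℕ :=
  (if (lynAux T).1 = 0 then (0 : Multiset ℕ) else {(lynAux T).1}) + (lynAux T).2

def combAux : CTree → ℕ × Multiset ℕ
  | leaf _ => (0, 0)
  | node _ l r =>
    let bl := (combAux l).1
    let ml := (combAux l).2
    let br := (combAux r).1
    let mr := (combAux r).2
    (1 + br, ml + mr + (if bl = 0 then 0 else {bl}))

/-- the comb type `λ^{Comb}`: multiset of block sizes of `π^{Comb}` -/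
def combType (T : CTree) : Multiset ℕ :=
  (if (combAux T).1 = 0 then (0 : Multiset ℕ) else {(combAux T).1}) + (combAux T).2

/-- subtrees (= nodes) of a tree -/
def subtreesC : CTree → List CTree
  | leaf m => [leaf m]
  | node c l r => node c l r :: (subtreesC l ++ subtreesC r)

end CTree

/-- normalized uncolored labeled binary trees on `[n]`: the set `Nor_n`. -/
def NorSet (n : ℕ) : Set CTree :=
  {T | T.OnSet n ∧ T.Normalized ∧ T.Mono}

/-- `Lyn_μ` for a weak composition `μ` (indexed by ℕ; `μ i` is the number of
internal nodes of color `i`). -/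
def LynSet (n : ℕ) (μ : ℕ →₀ ℕ) : Set CTree :=
  {T | T.OnSet n ∧ T.Normalized ∧ T.LynColored ∧ ∀ j, T.colorCount j = μ j}

/-- `Comb_μ` -/
def CombSet (n : ℕ) (μ : ℕ →₀ ℕ) : Set CTree :=
  {T | T.OnSet n ∧ T.Normalized ∧ T.CombColored ∧ ∀ j, T.colorCount j = μ j}

/-- `Lyn_μ` for `μ ∈ wcomp` with support in `[k]`, given as `f : Fin k → ℕ`. -/
def LynSetF (n k : ℕ) (f : Fin k → ℕ) : Set CTree :=
  {T | T.OnSet n ∧ T.Normalized ∧ T.LynColored ∧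
    ∀ j : ℕ, T.colorCount j = if h : j < k then f ⟨j, h⟩ else 0}

def CombSetF (n k : ℕ) (f : Fin k → ℕ) : Set CTree :=
  {T | T.OnSet n ∧ T.Normalized ∧ T.CombColored ∧
    ∀ j : ℕ, T.colorCount j = if h : j < k then f ⟨j, h⟩ else 0}

/-! Stirling permutations, as lists of natural numbers. -/

/-- `w` is a Stirling permutation on the finite set `A` of positive integers:
every letter of `A` occurs exactly twice, no other letter occurs, and every
letter lying strictly between the two occurrences of a letter `a` is larger
than `a`. -/
def IsStirling (A : Finset ℕ) (w : List ℕ) : Prop :=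
  (∀ a, w.count a = if a ∈ A then 2 else 0) ∧
  (∀ a b : ℕ, ∀ i l j : ℕ, i < l → l < j → w[i]? = some a → w[j]? = some a →
      w[l]? = some b → a < b)

/-- the set `Q_A` of Stirling permutations on `A` -/
def QSetA (A : Finset ℕ) : Set (List ℕ) := {w | IsStirling A w}

/-- the set `Q_m` of Stirling permutations on `[m]` -/
def QSet (m : ℕ) : Set (List ℕ) := QSetA (Finset.Icc 1 m)

/-- `(a,b)` is an ascending adjacent pair of `w`: `a < b` and the second
occurrence of `a` immediately precedes the first occurrence of `b`. -/
def AApair (w : List ℕ) (a b : ℕ) : Prop :=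
  a < b ∧ ∃ i, w[i]? = some a ∧ w[i+1]? = some b ∧
    (w.take (i+1)).count a = 2 ∧ (w.take (i+1)).count b = 0

/-- `(a,b)` is a terminally nested pair of `w`: `a < b` and the second
occurrence of `a` immediately follows the second occurrence of `b`. -/
def TNpair (w : List ℕ) (a b : ℕ) : Prop :=
  a < b ∧ ∃ i, w[i]? = some b ∧ w[i+1]? = some a ∧
    (w.take (i+1)).count b = 2 ∧ (w.take (i+2)).count a = 2

-- Given a relation `R` on letters which is a partial matching (as `AApair w`
-- and `TNpair w` are), the multiset of sizes of the blocks of the partition of `A`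
-- generated by `R`, i.e. the multiset of lengths of the maximal `R`-chains.
-- This gives the types `λ^{AA}` and `λ^{TN}` of a Stirling permutation.
open Classical in
noncomputable def chainType (A : Finset ℕ) (R : ℕ → ℕ → Prop) : Multiset ℕ :=
  ((A.image fun a => A.filter fun b => Relation.EqvGen R a b).val.map Finset.card)

/-- splits off the first block `a τ a` of a Stirling permutation. -/
def blockSplit (w : List ℕ) : List ℕ × List ℕ :=
  match w with
  | [] => ([], [])
  | a :: rest =>
    let i := rest.findIdx (· = a)
    (a :: rest.take (i+1), rest.drop (i+1))

/-- block factorization of a Stirling permutation (with fuel). -/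
def toBlocksAux : ℕ → List ℕ → List (List ℕ)
  | 0, _ => []
  | _+1, [] => []
  | f+1, w => (blockSplit w).1 :: toBlocksAux f (blockSplit w).2

def toBlocks (w : List ℕ) : List (List ℕ) := toBlocksAux w.length w

/-- splits a list of blocks at the first descent of the leading letters:
this gives the ascending adjacent factorization `θ = θ¹θ²`. -/
def splitAtDescent : List (List ℕ) → Option (List (List ℕ) × List (List ℕ))
  | [] => none
  | [_] => none
  | b :: b' :: rest =>
    if b'.headD 0 < b.headD 0 then some ([b], b' :: rest)
    else (splitAtDescent (b' :: rest)).map fun p => (b :: p.1, p.2)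

/-- the bijection `ξ : Q_A → Q_A` (with fuel).  On an irreducible AA-word
`a₁τ₁a₁ a₂τ₂a₂ ⋯ a_kτ_ka_k` it returns
`a₁ξ(τ₁) a₂ξ(τ₂) ⋯ a_{k-1}ξ(τ_{k-1}) a_k a_k a_{k-1} ⋯ a₂ a₁ ξ(τ_k)`, and it is
multiplicative on the complete ascending adjacent factorization. -/
def xiAux : ℕ → List ℕ → List ℕ
  | 0, w => w
  | f+1, w =>
    let bs := toBlocks w
    match splitAtDescent bs with
    | some p => xiAux f p.1.flatten ++ xiAux f p.2.flatten
    | none =>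
      match bs with
      | [] => []
      | _ =>
        let heads := bs.map fun b => b.headD 0
        let inners := bs.map fun b => (b.drop 1).dropLast
        (List.zipWith (fun a τ => a :: xiAux f τ) heads.dropLast inners.dropLast).flatten
          ++ (heads.getLastD 0 :: heads.reverse) ++ xiAux f (inners.getLastD [])

def xiMap (w : List ℕ) : List ℕ := xiAux (w.length + 1) w

/-- the subword of first occurrences of the letters of `w` (with fuel). -/
def initAux : ℕ → List ℕ → List ℕ
  | 0, _ => []
  | _+1, [] => []
  | f+1, a :: rest => a :: initAux f (rest.filter (· ≠ a))

/-- the initial permutation `init(θ)` -/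
def initPerm (w : List ℕ) : List ℕ := initAux w.length w

namespace CTree

/-- the map `γ̃ : Nor_A → Q̂_A` (recursive definition). -/
def gammaT : CTree → List ℕ
  | leaf m => [m, m]
  | node _ l r => (gammaT l).dropLast ++ gammaT r ++ [minLeaf l]

end CTree

/-- the reduction map `red : Q̂_n → Q_{n-1}` -/
def redList (w : List ℕ) : List ℕ := ((w.drop 1).dropLast).map (· - 1)

/-- the bijection `γ = red ∘ γ̃ : Nor_n → Q_{n-1}` -/
def gammaMap (T : CTree) : List ℕ := redList (CTree.gammaT T)

/-! ### Planar forests: an auxiliary encoding of trees and Stirling permutations -/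

/-- planar forests: `cons a t f` has first tree with root `a` and children `t`,
followed by the forest `f`. -/
inductive RF : Type
  | nil : RF
  | cons (a : ℕ) (t f : RF) : RF

namespace RF

def app : RF → RF → RF
  | nil, G => G
  | cons a t f, G => cons a t (app f G)

/-- labels in preorder -/
def lv : RF → List ℕ
  | nil => []
  | cons a t f => a :: (lv t ++ lv f)

/-- the associated word -/
def wd : RF → List ℕ
  | nil => []
  | cons a t f => a :: (wd t ++ a :: wd f)

def Incr : RF → Prop
  | nil => True
  | cons a t f => (∀ x ∈ lv t, a < x) ∧ Incr t ∧ Incr f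

def glue (a : ℕ) (X : RF) : RF → RF
  | nil => cons a nil X
  | cons b s R => if b < a then cons a nil (app X (cons b s R))
      else cons a (app X (cons b s nil)) R

def xi : RF → RF
  | nil => nil
  | cons a t f => glue a (xi t) (xi f)

def mp (g : ℕ → ℕ) : RF → RF
  | nil => nil
  | cons a t f => cons (g a) (mp g t) (mp g f)

def toTree : CTree → RF → CTree
  | acc, nil => acc
  | acc, cons a t f => toTree (CTree.node 0 acc (toTree (CTree.leaf a) t)) f

def toF : CTree → RF
  | CTree.leaf _ => nil
  | CTree.node _ l r => app (toF l) (cons (CTree.minLeaf r) (toF r) nil)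

@[simp] theorem app_nil (F : RF) : app F nil = F := by
  induction F with
  | nil => rfl
  | cons a t f _ ih => simp [app, ih]

@[simp] theorem app_assoc (F G H : RF) : app (app F G) H = app F (app G H) := by
  induction F with
  | nil => rfl
  | cons a t f _ ih => simp [app, ih]

@[simp] theorem lv_app (F G : RF) : lv (app F G) = lv F ++ lv G := by
  induction F with
  | nil => rfl
  | cons a t f _ ih => simp [app, lv, ih]

@[simp] theorem wd_app (F G : RF) : wd (app F G) = wd F ++ wd G := by
  induction F with
  | nil => rfl
  | cons a t f _ ih => simp [app, wd, ih]

theorem Incr_app (F G : RF) : Incr (app F G) ↔ Incr F ∧ Incr G := by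
  induction F with
  | nil => simp [app, Incr]
  | cons a t f _ ih => simp [app, Incr, ih, and_assoc]

theorem lv_glue (a : ℕ) (X Y : RF) : lv (glue a X Y) = a :: (lv X ++ lv Y) := by
  cases Y with
  | nil => simp [glue, lv]
  | cons b s R =>
    simp only [glue]
    split_ifs <;> simp [lv]

@[simp] theorem lv_xi (F : RF) : lv (xi F) = lv F := by
  induction F with
  | nil => rfl
  | cons a t f iht ihf => simp [xi, lv_glue, iht, ihf, lv]

theorem xi_head (a : ℕ) (t f : RF) : ∃ s R, xi (cons a t f) = cons a s R := by
  simp only [xi]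
  cases xi f with
  | nil => exact ⟨_, _, rfl⟩
  | cons b s R =>
    simp only [glue]
    split_ifs <;> exact ⟨_, _, rfl⟩

theorem Incr_xi (F : RF) (h : Incr F) (hn : (lv F).Nodup) : Incr (xi F) := by
  induction F with
  | nil => exact h
  | cons a t f iht ihf =>
    obtain ⟨h1, h2, h3⟩ := h
    simp only [lv, List.nodup_cons, List.nodup_append, List.mem_append, not_or] at hn
    obtain ⟨⟨ha1, ha2⟩, hn1, hn2, hn3⟩ := hn
    have iht := iht h2 hn1
    have ihf := ihf h3 hn2
    have hf := lv_xi f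
    simp only [xi]
    generalize xi f = Y at ihf hf
    cases Y with
    | nil => simpa [glue, Incr, lv] using iht
    | cons b s R =>
      have hb : b ∈ lv f := by rw [← hf]; simp [lv]
      have hab : a ≠ b := fun e => ha2 (e ▸ hb)
      obtain ⟨g1, g2, g3⟩ := ihf
      simp only [glue]
      split_ifs with hlt
      · simp only [Incr, lv, Incr_app]
        exact ⟨by simp, trivial, iht, g1, g2, g3⟩
      · have hab' : a < b := by omega
        simp only [Incr, lv, Incr_app, lv_app, lv_xi]
        refine ⟨?_, ⟨iht, g1, g2, trivial⟩, g3⟩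
        intro x hx
        simp only [List.mem_append, List.mem_cons, List.append_nil] at hx
        rcases hx with hx | hx | hx
        · exact h1 x hx
        · omega
        · exact hab'.trans (g1 x hx)

/-! injectivity -/

/-- the forest is empty or starts with a letter smaller than `a` -/
def HdLt (a : ℕ) : RF → Prop
  | nil => True
  | cons b _ _ => b < a

theorem app_split (a : ℕ) (X X' Y Y' : RF) (hX : ∀ x ∈ lv X, a < x) (hX' : ∀ x ∈ lv X', a < x)
    (hY : HdLt a Y) (hY' : HdLt a Y') (h : app X Y = app X' Y') : X = X' ∧ Y = Y' := by
  induction X generalizing X' with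
  | nil =>
    cases X' with
    | nil => exact ⟨rfl, h⟩
    | cons b s R =>
      simp only [app] at h
      subst h
      have := hX' b (by simp [lv])
      simp only [HdLt] at hY
      omega
  | cons c t f _ ih =>
    cases X' with
    | nil =>
      simp only [app] at h
      subst h
      have := hX c (by simp [lv])
      simp only [HdLt] at hY'
      omega
    | cons b s R =>
      simp only [app, cons.injEq] at h
      obtain ⟨rfl, rfl, h⟩ := h
      obtain ⟨rfl, rfl⟩ := ih R (fun x hx => hX x (by simp [lv, hx]))
        (fun x hx => hX' x (by simp [lv, hx])) h
      exact ⟨rfl, rfl⟩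

theorem app_single_ne_nil (X : RF) (b : ℕ) (s R : RF) : app X (cons b s R) ≠ nil := by
  cases X <;> simp [app]

theorem app_single_inj (X X' : RF) (b b' : ℕ) (s s' : RF)
    (h : app X (cons b s nil) = app X' (cons b' s' nil)) : X = X' ∧ b = b' ∧ s = s' := by
  induction X generalizing X' with
  | nil =>
    cases X' with
    | nil => simpa [app] using h
    | cons c t f =>
      simp only [app, cons.injEq] at h
      exact absurd h.2.2.symm (app_single_ne_nil _ _ _ _)
  | cons c t f _ ih =>
    cases X' with
    | nil =>
      simp only [app, cons.injEq] at h
      exact absurd h.2.2 (app_single_ne_nil _ _ _ _)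
    | cons c' t' f' =>
      simp only [app, cons.injEq] at h
      obtain ⟨rfl, rfl, h⟩ := h
      obtain ⟨rfl, rfl, rfl⟩ := ih f' h
      exact ⟨rfl, rfl, rfl⟩

theorem glue_cases (a : ℕ) (X Y : RF) :
    (HdLt a Y ∧ glue a X Y = cons a nil (app X Y)) ∨
    (∃ b s R, Y = cons b s R ∧ ¬ b < a ∧ glue a X Y = cons a (app X (cons b s nil)) R) := by
  cases Y with
  | nil => left; simp [HdLt, glue]
  | cons b s R =>
    by_cases h : b < a
    · left; simp [HdLt, glue, h]
    · right; exact ⟨b, s, R, rfl, h, by simp [glue, h]⟩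

theorem glue_inj (a a' : ℕ) (X X' Y Y' : RF) (hX : ∀ x ∈ lv X, a < x) (hX' : ∀ x ∈ lv X', a' < x)
    (h : glue a X Y = glue a' X' Y') : a = a' ∧ X = X' ∧ Y = Y' := by
  rcases glue_cases a X Y with ⟨h1, e⟩ | ⟨b, s, R, rfl, h1, e⟩ <;>
  rcases glue_cases a' X' Y' with ⟨h2, e'⟩ | ⟨b', s', R', rfl, h2, e'⟩ <;>
  rw [e, e'] at h <;> simp only [cons.injEq] at h
  · obtain ⟨rfl, -, h⟩ := h
    exact ⟨rfl, app_split a X X' Y Y' hX hX' h1 h2 h⟩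
  · exact absurd h.2.1.symm (app_single_ne_nil _ _ _ _)
  · exact absurd h.2.1 (app_single_ne_nil _ _ _ _)
  · obtain ⟨rfl, h, rfl⟩ := h
    obtain ⟨rfl, rfl, rfl⟩ := app_single_inj _ _ _ _ _ _ h
    exact ⟨rfl, rfl, rfl⟩

theorem xi_inj (F G : RF) (hF : Incr F) (hG : Incr G) (h : xi F = xi G) : F = G := by
  induction F generalizing G with
  | nil =>
    cases G with
    | nil => rfl
    | cons a t f =>
      obtain ⟨s, R, e⟩ := xi_head a t f
      rw [e] at h
      simp [xi] at h
  | cons a t f iht ihf =>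
    cases G with
    | nil =>
      obtain ⟨s, R, e⟩ := xi_head a t f
      rw [e] at h
      simp [xi] at h
    | cons a' t' f' =>
      simp only [xi] at h
      obtain ⟨h1, h2, h3⟩ := hF
      obtain ⟨g1, g2, g3⟩ := hG
      obtain ⟨rfl, e1, e2⟩ := glue_inj a a' _ _ _ _ (by simpa using h1) (by simpa using g1) h
      rw [iht _ h2 g2 e1, ihf _ h3 g3 e2]

/-! surjectivity -/

theorem exists_split (a : ℕ) (Y : RF) (hY : Incr Y) (ha : a ∉ lv Y) :
    ∃ P Q, Y = app P Q ∧ (∀ x ∈ lv P, a < x) ∧ HdLt a Q := by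
  induction Y with
  | nil => exact ⟨nil, nil, rfl, by simp [lv], trivial⟩
  | cons b t f _ ih =>
    obtain ⟨h1, h2, h3⟩ := hY
    simp only [lv, List.mem_cons, List.mem_append, not_or] at ha
    by_cases h : b < a
    · exact ⟨nil, _, rfl, by simp [lv], h⟩
    · obtain ⟨P, Q, rfl, hP, hQ⟩ := ih h3 ha.2.2
      refine ⟨cons b t P, Q, rfl, ?_, hQ⟩
      intro x hx
      simp only [lv, List.mem_cons, List.mem_append] at hx
      rcases hx with rfl | hx | hx
      · omega
      · have := h1 x hx
        omega
      · exact hP x hx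

theorem exists_snoc (b : ℕ) (s X : RF) : ∃ P c u, cons b s X = app P (cons c u nil) := by
  induction X generalizing b s with
  | nil => exact ⟨nil, b, s, rfl⟩
  | cons c u f _ ih =>
    obtain ⟨P, c', u', e⟩ := ih c u
    exact ⟨cons b s P, c', u', by simp [app, e]⟩

theorem glue_of_HdLt (a : ℕ) (X Y : RF) (h : HdLt a Y) : glue a X Y = cons a nil (app X Y) := by
  cases Y with
  | nil => simp [glue]
  | cons b s R =>
    simp only [HdLt] at h
    simp [glue, h]

theorem xi_surj (k : ℕ) : ∀ G : RF, (lv G).length ≤ k → Incr G → (lv G).Nodup →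
    ∃ F, Incr F ∧ xi F = G := by
  induction k with
  | zero =>
    intro G hk _ _
    cases G with
    | nil => exact ⟨nil, trivial, rfl⟩
    | cons a t f => simp [lv] at hk
  | succ k ih =>
    intro G hk hG hn
    cases G with
    | nil => exact ⟨nil, trivial, rfl⟩
    | cons a X Y =>
      obtain ⟨h1, h2, h3⟩ := hG
      cases X with
      | nil =>
        simp only [lv, List.nil_append, List.nodup_cons] at hn
        obtain ⟨P, Q, rfl, hP, hQ⟩ := exists_split a Y h3 hn.1
        rw [Incr_app] at h3
        rw [lv_app, List.nodup_append] at hn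
        simp only [lv, lv_app, List.length_append, List.length_cons, List.length_nil] at hk
        obtain ⟨t, ht, rfl⟩ := ih P (by omega) h3.1 hn.2.1
        obtain ⟨f, hf, rfl⟩ := ih Q (by omega) h3.2 hn.2.2.1
        refine ⟨cons a t f, ⟨by simpa using hP, ht, hf⟩, ?_⟩
        simp only [xi]
        exact glue_of_HdLt _ _ _ hQ
      | cons b s X =>
        obtain ⟨P, c, u, e⟩ := exists_snoc b s X
        rw [e] at hk hn h1 h2
        rw [e]
        simp only [lv, lv_app, List.length_append, List.length_cons, List.length_nil] at hk
        rw [Incr_app] at h2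
        obtain ⟨g1, g2, g3, -⟩ := h2
        simp only [lv, lv_app, List.append_nil, List.nodup_cons] at hn
        have hn2 := hn.2
        rw [List.append_assoc, List.nodup_append] at hn2
        obtain ⟨t, ht, rfl⟩ := ih P (by omega) g1 hn2.1
        obtain ⟨f, hf, hfe⟩ := ih (cons c u Y)
          (by simp only [lv, List.length_append, List.length_cons]; omega) ⟨g2, g3, h3⟩
          (by simpa [lv] using hn2.2.1)
        refine ⟨cons a t f, ⟨fun x hx => h1 x (by simp [hx]), ht, hf⟩, ?_⟩
        have hc := h1 c (by simp [lv])
        simp only [xi, hfe, glue]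
        rw [if_neg (by omega)]

/-! words -/

def blocks : RF → List (List ℕ)
  | nil => []
  | cons a t f => (a :: (wd t ++ [a])) :: blocks f

theorem mem_wd (F : RF) (x : ℕ) : x ∈ wd F ↔ x ∈ lv F := by
  induction F with
  | nil => simp [wd, lv]
  | cons a t f iht ihf =>
    simp [wd, lv, iht, ihf]
    tauto

theorem blockSplit_wd (a : ℕ) (u v : List ℕ) (h : a ∉ u) :
    blockSplit (a :: (u ++ a :: v)) = (a :: (u ++ [a]), v) := by
  have hi : (u ++ a :: v).findIdx (· = a) = u.length := by
    rw [List.findIdx_append]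
    have : u.findIdx (fun x => decide (x = a)) = u.length := by
      rw [List.findIdx_eq_length]
      intro x hx
      simp only [decide_eq_false_iff_not]
      rintro rfl
      exact h hx
    rw [this]
    simp [List.findIdx_cons]
  simp only [blockSplit, hi]
  simp [List.take_append, List.drop_append]

theorem toBlocksAux_wd (F : RF) (h : Incr F) (k : ℕ) (hk : (wd F).length ≤ k) :
    toBlocksAux k (wd F) = blocks F := by
  induction F generalizing k with
  | nil => cases k <;> simp [wd, toBlocksAux, blocks]
  | cons a t f _ ih =>
    obtain ⟨h1, h2, h3⟩ := h
    cases k with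
    | zero => simp [wd] at hk
    | succ k =>
      have ha : a ∉ wd t := fun hh => lt_irrefl a (h1 a ((mem_wd t a).1 hh))
      simp only [wd, toBlocksAux, blockSplit_wd a _ _ ha, blocks]
      rw [ih h3]
      simp only [wd, List.length_cons, List.length_append] at hk
      omega

theorem toBlocks_wd (F : RF) (h : Incr F) : toBlocks (wd F) = blocks F :=
  toBlocksAux_wd F h _ le_rfl

theorem blocks_flatten (F : RF) : (blocks F).flatten = wd F := by
  induction F with
  | nil => rfl
  | cons a t f _ ih => simp [blocks, wd, ih]

theorem split_blocks (a b : ℕ) (t s f : RF) :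
    splitAtDescent (blocks (cons a t (cons b s f))) =
      if b < a then some ([a :: (wd t ++ [a])], blocks (cons b s f))
      else (splitAtDescent (blocks (cons b s f))).map
        fun p => ((a :: (wd t ++ [a])) :: p.1, p.2) := rfl

theorem split_some (F : RF) (p : List (List ℕ) × List (List ℕ))
    (h : splitAtDescent (blocks F) = some p) :
    ∃ b s G H, F = app (cons b s G) H ∧ H ≠ nil ∧ p = (blocks (cons b s G), blocks H) ∧
      xi F = app (xi (cons b s G)) (xi H) := by
  induction F generalizing p with
  | nil => simp [blocks, splitAtDescent] at h
  | cons a t f _ ih =>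
    cases f with
    | nil => simp [blocks, splitAtDescent] at h
    | cons b s f =>
      rw [split_blocks] at h
      obtain ⟨u, R, e⟩ := xi_head b s f
      by_cases hlt : b < a
      · rw [if_pos hlt] at h
        simp only [Option.some.injEq] at h
        refine ⟨a, t, nil, cons b s f, rfl, by simp, by simp [← h, blocks], ?_⟩
        rw [xi, e]
        simp [xi, glue, hlt, app]
      · rw [if_neg hlt] at h
        simp only [Option.map_eq_some_iff] at h
        obtain ⟨q, hq, rfl⟩ := h
        obtain ⟨b', s', G, H, e1, hH, rfl, e2⟩ := ih q (by simpa [blocks] using hq)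
        simp only [app, cons.injEq] at e1
        obtain ⟨rfl, rfl, rfl⟩ := e1
        refine ⟨a, t, cons b s G, H, rfl, hH, rfl, ?_⟩
        obtain ⟨u', R', e'⟩ := xi_head b s G
        rw [xi, e2, xi.eq_2 a t, e']
        simp [glue, hlt, app]

/-- the property `P` holds for the children forests of all roots -/
def AllCh (P : RF → Prop) : RF → Prop
  | nil => True
  | cons _ t f => P t ∧ AllCh P f

theorem split_none (g : List ℕ → List ℕ) (F : RF) (hF : F ≠ nil)
    (h : splitAtDescent (blocks F) = none)
    (hg : AllCh (fun t => g (wd t) = wd (xi t)) F) :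
    ∃ b s R, xi F = cons b s R ∧
      wd R = g (((blocks F).map fun b => (b.drop 1).dropLast).getLastD []) ∧
      b :: (wd s ++ [b]) =
        (List.zipWith (fun a τ => a :: g τ) ((blocks F).map fun b => b.headD 0).dropLast
          ((blocks F).map fun b => (b.drop 1).dropLast).dropLast).flatten
          ++ (((blocks F).map fun b => b.headD 0).getLastD 0 ::
            ((blocks F).map fun b => b.headD 0).reverse) := by
  induction F with
  | nil => exact absurd rfl hF
  | cons a t f _ ih =>
    obtain ⟨hg1, hg2⟩ := hg
    cases f with
    | nil =>
      refine ⟨a, nil, xi t, by simp [xi, glue], ?_, ?_⟩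
      · simp [blocks, hg1]
      · simp [blocks, wd]
    | cons b s f =>
      rw [split_blocks] at h
      have hlt : ¬ b < a := by
        intro hlt
        rw [if_pos hlt] at h
        simp at h
      rw [if_neg hlt] at h
      simp only [Option.map_eq_none_iff] at h
      obtain ⟨b', s', R, e1, e2, e3⟩ := ih (by simp) (by simpa [blocks] using h) hg2
      obtain ⟨u, R', e⟩ := xi_head b s f
      have e0 := e1
      rw [e] at e0
      simp only [cons.injEq] at e0
      obtain ⟨rfl, rfl, rfl⟩ := e0
      refine ⟨a, app (xi t) (cons b u nil), R', ?_, ?_, ?_⟩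
      · rw [xi, e1]
        simp [glue, hlt]
      · rw [e2]
        simp [blocks]
      · have e4 : wd (cons b u nil) = b :: (wd u ++ [b]) := by simp [wd]
        rw [wd_app, e4, e3]
        simp [blocks, hg1]

theorem AllCh_of (P : RF → Prop) (F : RF)
    (h : ∀ t, Incr t → (wd t).length < (wd F).length → P t) (hF : Incr F) : AllCh P F := by
  induction F with
  | nil => trivial
  | cons a t f _ ih =>
    obtain ⟨h1, h2, h3⟩ := hF
    refine ⟨h t h2 ?_, ih (fun t' ht' hl => h t' ht' ?_) h3⟩
    · simp only [wd, List.length_cons, List.length_append]; omega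
    · simp only [wd, List.length_cons, List.length_append]; omega

theorem wd_pos (F : RF) (h : F ≠ nil) : 0 < (wd F).length := by
  cases F with
  | nil => exact absurd rfl h
  | cons a t f => simp [wd]

theorem xiAux_wd (k : ℕ) : ∀ F : RF, Incr F → (wd F).length < k → xiAux k (wd F) = wd (xi F) := by
  induction k with
  | zero => intro F _ h; omega
  | succ k ih =>
    intro F hF hk
    rw [xiAux]
    simp only [toBlocks_wd F hF]
    split
    · rename_i p hp
      obtain ⟨b, s, G, H, e, hH, rfl, e2⟩ := split_some F p hp
      rw [e2, wd_app]
      simp only [blocks_flatten]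
      rw [e, wd_app, List.length_append] at hk
      rw [e, Incr_app] at hF
      have := wd_pos H hH
      have := wd_pos (cons b s G) (by simp)
      rw [ih _ hF.1 (by omega), ih _ hF.2 (by omega)]
    · rename_i hp
      by_cases hne : F = nil
      · subst hne
        simp [blocks, xi, wd]
      · obtain ⟨b, s, R, e1, e2, e3⟩ := split_none (xiAux k) F hne hp
          (AllCh_of _ F (fun t ht hl => ih t ht (by omega)) hF)
        have hw : wd (cons b s R) = (b :: (wd s ++ [b])) ++ wd R := by simp [wd]
        rw [e1, hw, e2, e3]
        split
        · rename_i hb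
          cases F with
          | nil => exact absurd rfl hne
          | cons a t f => simp [blocks] at hb
        · rfl

theorem xiMap_wd (F : RF) (hF : Incr F) : xiMap (wd F) = wd (xi F) :=
  xiAux_wd _ F hF (by omega)

/-! relabelling -/

theorem mp_app (g : ℕ → ℕ) (F G : RF) : mp g (app F G) = app (mp g F) (mp g G) := by
  induction F with
  | nil => rfl
  | cons a t f _ ih => simp [app, mp, ih]

theorem wd_mp (g : ℕ → ℕ) (F : RF) : wd (mp g F) = (wd F).map g := by
  induction F with
  | nil => rfl
  | cons a t f iht ihf => simp [mp, wd, iht, ihf]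

theorem lv_mp (g : ℕ → ℕ) (F : RF) : lv (mp g F) = (lv F).map g := by
  induction F with
  | nil => rfl
  | cons a t f iht ihf => simp [mp, lv, iht, ihf]

theorem Incr_mp (F : RF) (hF : Incr F) (h : ∀ x ∈ lv F, 1 ≤ x) : Incr (mp (· - 1) F) := by
  induction F with
  | nil => trivial
  | cons a t f iht ihf =>
    obtain ⟨h1, h2, h3⟩ := hF
    refine ⟨?_, iht h2 (fun x hx => h x (by simp [lv, hx])),
      ihf h3 (fun x hx => h x (by simp [lv, hx]))⟩
    intro x hx
    simp only [lv_mp, List.mem_map] at hx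
    obtain ⟨y, hy, rfl⟩ := hx
    have := h1 y hy
    have := h a (by simp [lv])
    show a - 1 < y - 1
    omega

theorem xi_mp (F : RF) (h : ∀ x ∈ lv F, 1 ≤ x) : xi (mp (· - 1) F) = mp (· - 1) (xi F) := by
  induction F with
  | nil => rfl
  | cons a t f iht ihf =>
    rw [mp, xi, xi, iht (fun x hx => h x (by simp [lv, hx])),
      ihf (fun x hx => h x (by simp [lv, hx]))]
    have ha := h a (by simp [lv])
    have hf := lv_xi f
    generalize xi f = Y at hf
    cases Y with
    | nil => simp [mp, glue]
    | cons b s R =>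
      have hb := h b (by simp [lv, ← hf])
      simp only [mp, glue]
      by_cases hlt : b < a
      · rw [if_pos hlt, if_pos (by omega)]
        simp [mp, mp_app]
      · rw [if_neg hlt, if_neg (by omega)]
        simp [mp, mp_app]

/-! trees versus forests -/

theorem toTree_app (T : CTree) (F G : RF) : toTree T (app F G) = toTree (toTree T F) G := by
  induction F generalizing T with
  | nil => rfl
  | cons a t f _ ih => simp [app, toTree, ih]

theorem leaves_toTree (F : RF) : ∀ T, CTree.leavesList (toTree T F) = CTree.leavesList T ++ lv F := by
  induction F with
  | nil => intro T; simp [toTree, lv]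
  | cons a t f iht ihf => intro T; simp [toTree, lv, ihf, iht, CTree.leavesList]

theorem mono_toTree (F : RF) : ∀ T, CTree.Mono T → CTree.Mono (toTree T F) := by
  induction F with
  | nil => intro T h; exact h
  | cons a t f iht ihf => intro T h; exact ihf _ ⟨rfl, h, iht _ trivial⟩

theorem norm_toTree (F : RF) : ∀ T, CTree.Normalized T → Incr F → (∀ x ∈ lv F, CTree.minLeaf T < x) →
    CTree.Normalized (toTree T F) ∧ CTree.minLeaf (toTree T F) = CTree.minLeaf T := by
  induction F with
  | nil => intro T h _ _; exact ⟨h, rfl⟩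
  | cons a t f iht ihf =>
    intro T h hF hl
    obtain ⟨h1, h2, h3⟩ := hF
    obtain ⟨g1, g2⟩ := iht (CTree.leaf a) trivial h2 h1
    have ha := hl a (by simp [lv])
    simp only [CTree.minLeaf] at g2
    have hm : CTree.minLeaf (CTree.node 0 T (toTree (CTree.leaf a) t)) = CTree.minLeaf T := by
      simp only [CTree.minLeaf, g2]; omega
    obtain ⟨k1, k2⟩ := ihf (CTree.node 0 T (toTree (CTree.leaf a) t)) ⟨h, g1, by omega⟩ h3
      (fun x hx => by rw [hm]; exact hl x (by simp [lv, hx]))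
    exact ⟨k1, by rw [toTree, k2, hm]⟩

theorem toF_toTree (F : RF) : ∀ T, Incr F → toF (toTree T F) = app (toF T) F := by
  induction F with
  | nil => intro T _; simp [toTree]
  | cons a t f iht ihf =>
    intro T hF
    obtain ⟨h1, h2, h3⟩ := hF
    have hm := (norm_toTree t (CTree.leaf a) trivial h2 h1).2
    simp only [CTree.minLeaf] at hm
    rw [toTree, ihf _ h3, toF, iht _ h2, hm]
    simp [toF, app]

theorem toF_spec (T : CTree) (h : CTree.Normalized T) :
    CTree.leavesList T = CTree.minLeaf T :: lv (toF T) ∧ Incr (toF T) ∧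
      (∀ x ∈ lv (toF T), CTree.minLeaf T < x) := by
  induction T with
  | leaf m => simp [CTree.leavesList, CTree.minLeaf, toF, lv, Incr]
  | node c l r ihl ihr =>
    obtain ⟨h1, h2, h3⟩ := h
    obtain ⟨l1, l2, l3⟩ := ihl h1
    obtain ⟨r1, r2, r3⟩ := ihr h2
    have hm : CTree.minLeaf (CTree.node c l r) = CTree.minLeaf l := by
      simp only [CTree.minLeaf]; omega
    refine ⟨?_, ?_, ?_⟩
    · rw [hm]
      simp [CTree.leavesList, l1, r1, toF, lv]
    · simp only [toF, Incr_app, Incr]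
      exact ⟨l2, r3, r2, trivial⟩
    · rw [hm]
      intro x hx
      simp only [toF, lv_app, lv, List.append_nil, List.mem_append, List.mem_cons] at hx
      rcases hx with hx | rfl | hx
      · exact l3 x hx
      · exact h3
      · exact h3.trans (r3 x hx)

theorem toTree_toF (T : CTree) (h : CTree.Normalized T) (hm : CTree.Mono T) :
    toTree (CTree.leaf (CTree.minLeaf T)) (toF T) = T := by
  induction T with
  | leaf m => rfl
  | node c l r ihl ihr =>
    obtain ⟨h1, h2, h3⟩ := h
    obtain ⟨rfl, m1, m2⟩ := hm
    have hm : CTree.minLeaf (CTree.node 0 l r) = CTree.minLeaf l := by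
      simp only [CTree.minLeaf]; omega
    rw [hm, toF, toTree_app, ihl h1 m1]
    simp [toTree, ihr h2 m2]

theorem gammaT_toF (T : CTree) (h : CTree.Normalized T) :
    CTree.gammaT T = CTree.minLeaf T :: (wd (toF T) ++ [CTree.minLeaf T]) := by
  induction T with
  | leaf m => rfl
  | node c l r ihl ihr =>
    obtain ⟨h1, h2, h3⟩ := h
    have hm : CTree.minLeaf (CTree.node c l r) = CTree.minLeaf l := by
      simp only [CTree.minLeaf]; omega
    have hd : (CTree.minLeaf l :: (wd (toF l) ++ [CTree.minLeaf l])).dropLast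
        = CTree.minLeaf l :: wd (toF l) := by
      rw [← List.cons_append, List.dropLast_concat]
    rw [hm, CTree.gammaT, ihl h1, ihr h2, hd]
    simp [toF, wd]

theorem gammaMap_toF (T : CTree) (h : CTree.Normalized T) :
    gammaMap T = wd (mp (· - 1) (toF T)) := by
  rw [gammaMap, gammaT_toF T h, redList, wd_mp]
  simp

/-! comb type and Lyndon type -/

/-- close a pair (open block, closed blocks) -/
def cl (p : ℕ × Multiset ℕ) : Multiset ℕ := (if p.1 = 0 then 0 else {p.1}) + p.2

def cb : RF → ℕ × Multiset ℕ
  | nil => (0, 0)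
  | cons _ t nil => (1 + (cb t).1, (cb t).2)
  | cons _ t (cons b s f) => ((cb (cons b s f)).1, {1 + (cb t).1} + (cb t).2 + (cb (cons b s f)).2)

theorem cl_cb_cons (a : ℕ) (t f : RF) :
    cl (cb (cons a t f)) = {1 + (cb t).1} + (cb t).2 + cl (cb f) := by
  cases f with
  | nil => simp [cb, cl]
  | cons b s f =>
    simp only [cb, cl]
    ac_rfl

theorem cb_app (X : RF) (b : ℕ) (s f : RF) :
    cb (app X (cons b s f)) = ((cb (cons b s f)).1, cl (cb X) + (cb (cons b s f)).2) := by
  induction X with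
  | nil => simp [app, cb, cl]
  | cons a t X _ ih =>
    rw [cl_cb_cons]
    cases X with
    | nil =>
      simp only [app, cb, cl]
      simp
    | cons a' t' X =>
      rw [app]
      simp only [app] at ih ⊢
      rw [cb, ih]
      simp only [add_assoc]

theorem cl_cb_app (X Y : RF) : cl (cb (app X Y)) = cl (cb X) + cl (cb Y) := by
  cases Y with
  | nil => simp [cb, cl]
  | cons b s f =>
    rw [cb_app]
    simp only [cl]
    abel

theorem combAux_toF (T : CTree) : CTree.combAux T = cb (toF T) := by
  induction T with
  | leaf m => rfl
  | node c l r ihl ihr =>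
    rw [toF, cb_app]
    simp only [CTree.combAux, ihl, ihr, cb, cl]
    congr 1
    abel

/-- first ascending run, and the other runs -/
def ly : RF → ℕ × Multiset ℕ
  | nil => (0, 0)
  | cons _ t nil => (1, cl (ly t))
  | cons a t (cons b s f) =>
      if b < a then (1, cl (ly t) + cl (ly (cons b s f)))
      else (1 + (ly (cons b s f)).1, cl (ly t) + (ly (cons b s f)).2)

theorem ly_pos (a : ℕ) (t f : RF) : (ly (cons a t f)).1 ≠ 0 := by
  cases f with
  | nil => simp [ly]
  | cons b s f =>
    rw [ly]
    split_ifs <;> simp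

theorem lynAux_pos (c : ℕ) (l r : CTree) : (CTree.lynAux (CTree.node c l r)).1 ≠ 0 := by
  simp only [CTree.lynAux]
  split_ifs <;> simp

/-- combine a left tree and a forest placed to its right along the spine -/
theorem lynType_toTree (F : RF) : ∀ T, Incr F →
    CTree.lynType (toTree T F) =
      match T, F with
      | CTree.node _ l r, cons a t f =>
        if a < CTree.minLeaf r then CTree.lynType (CTree.node 0 l r) + cl (ly (cons a t f))
        else {(CTree.lynAux (CTree.node 0 l r)).1 + (ly (cons a t f)).1} +
          (CTree.lynAux (CTree.node 0 l r)).2 + (ly (cons a t f)).2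
      | T, F => CTree.lynType T + cl (ly F) := by
  induction F with
  | nil => intro T _; cases T <;> simp [toTree, ly, cl]
  | cons a t f iht ihf =>
    intro T hF
    obtain ⟨h1, h2, h3⟩ := hF
    have hm := (norm_toTree t (CTree.leaf a) trivial h2 h1).2
    simp only [CTree.minLeaf] at hm
    have ht : CTree.lynType (toTree (CTree.leaf a) t) = cl (ly t) := by
      rw [iht _ h2]
      simp [CTree.lynType, CTree.lynAux]
    have ht' : (CTree.lynAux (toTree (CTree.leaf a) t)).2 +
        (if (CTree.lynAux (toTree (CTree.leaf a) t)).1 = 0 then 0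
          else {(CTree.lynAux (toTree (CTree.leaf a) t)).1}) = cl (ly t) := by
      rw [← ht, CTree.lynType, add_comm]
    have hcl : ∀ p : ℕ × Multiset ℕ, p.1 ≠ 0 → cl p = {p.1} + p.2 := by
      intro p hp
      simp [cl, hp]
    have hty : ∀ T, CTree.lynType T = cl (CTree.lynAux T) := fun _ => rfl
    have hty0 : ∀ m, CTree.lynType (CTree.leaf m) = 0 := by
      intro m
      simp [CTree.lynType, CTree.lynAux]
    rw [toTree, ihf _ h3]
    clear ihf iht
    generalize toTree (CTree.leaf a) t = r at hm ht ht'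
    cases T with
    | leaf m =>
      have e : CTree.lynAux (CTree.node 0 (CTree.leaf m) r) = (1, cl (ly t)) := by
        rw [CTree.lynAux]
        simp only [ht']
        simp [CTree.RootLyndonB, CTree.left, CTree.isLeafB, CTree.lynAux]
      cases f with
      | nil =>
        simp only [hty0, hty (CTree.node _ _ _), e, ly]
        simp [cl]
      | cons b s f =>
        have hq := ly_pos b s f
        simp only [hm, hty0, hty (CTree.node _ _ _), e, ly]
        by_cases hba : b < a
        · simp only [if_pos hba]
          rw [hcl (1, _) one_ne_zero, hcl (1, _) one_ne_zero]
          simp only [zero_add, add_assoc]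
        · simp only [if_neg hba]
          rw [hcl (1 + _, _) (by simp)]
          simp only [zero_add, add_assoc]
    | node c l r0 =>
      have e : CTree.lynAux (CTree.node 0 (CTree.node c l r0) r) =
          if a < CTree.minLeaf r0 then (1, cl (CTree.lynAux (CTree.node 0 l r0)) + cl (ly t))
          else (1 + (CTree.lynAux (CTree.node 0 l r0)).1,
            (CTree.lynAux (CTree.node 0 l r0)).2 + cl (ly t)) := by
        have e0 : CTree.lynAux (CTree.node c l r0) = CTree.lynAux (CTree.node 0 l r0) := rfl
        rw [CTree.lynAux]
        simp only [ht', e0]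
        simp only [CTree.RootLyndonB, CTree.left, CTree.right, CTree.isLeafB, hm,
          Bool.false_or, decide_eq_true_eq, cl]
        rw [add_comm (CTree.lynAux (CTree.node 0 l r0)).2 (ite _ _ _)]
      have hp := lynAux_pos 0 l r0
      cases f with
      | nil =>
        simp only [hty (CTree.node _ _ _), e, hm, ly]
        generalize CTree.lynAux (CTree.node 0 l r0) = A at hp
        by_cases hlt : a < CTree.minLeaf r0
        · simp only [if_pos hlt]
          rw [hcl (1, _) one_ne_zero, hcl (1, _) one_ne_zero]
          simp only [cl, if_true, add_zero]
          ac_rfl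
        · simp only [if_neg hlt]
          rw [hcl (1 + _, _) (by simp)]
          simp only [cl, if_true, add_zero, add_comm 1 A.1]
          ac_rfl
      | cons b s f =>
        have hq := ly_pos b s f
        simp only [hty (CTree.node _ _ _), e, hm, ly]
        generalize CTree.lynAux (CTree.node 0 l r0) = A at hp
        generalize ly (cons b s f) = B at hq
        generalize cl (ly t) = C
        by_cases hlt : a < CTree.minLeaf r0 <;> by_cases hba : b < a <;>
          simp only [hlt, hba, if_true, if_false]
        · rw [hcl (1, _) one_ne_zero, hcl (1, _) one_ne_zero]
          simp only
          ac_rfl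
        · rw [hcl (1 + B.1, _) (by simp)]
          simp only
          ac_rfl
        · rw [hcl (1 + A.1, _) (by simp), add_comm 1 A.1]
          simp only
          ac_rfl
        · have : A.1 + (1 + B.1) = 1 + A.1 + B.1 := by omega
          rw [this]
          ac_rfl

theorem lynType_toF (T : CTree) (h : CTree.Normalized T) (hm : CTree.Mono T) :
    CTree.lynType T = cl (ly (toF T)) := by
  have := lynType_toTree (toF T) (CTree.leaf (CTree.minLeaf T)) (toF_spec T h).2.1
  rw [toTree_toF T h hm] at this
  rw [this]
  simp [CTree.lynType, CTree.lynAux]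

theorem cb_xi_aux (F : RF) : cl (cb (xi F)) = cl (ly F) ∧
    ∀ a s R, xi F = cons a s R → 1 + (cb s).1 = (ly F).1 ∧ (cb s).2 + cl (cb R) = (ly F).2 := by
  induction F with
  | nil => exact ⟨rfl, by simp [xi]⟩
  | cons a t f iht ihf =>
    have key : ∀ a' s R, xi (cons a t f) = cons a' s R →
        1 + (cb s).1 = (ly (cons a t f)).1 ∧ (cb s).2 + cl (cb R) = (ly (cons a t f)).2 := by
      intro a' s R h
      cases f with
      | nil =>
        simp only [xi, glue, cons.injEq] at h
        obtain ⟨rfl, rfl, rfl⟩ := h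
        simp [cb, ly, iht.1]
      | cons b u f =>
        obtain ⟨v, Q, e⟩ := xi_head b u f
        obtain ⟨k1, k2⟩ := ihf.2 _ _ _ e
        have k3 := ihf.1
        rw [xi, e, glue] at h
        rw [e] at k3
        rw [ly]
        split_ifs at h ⊢ with hlt
        · simp only [cons.injEq] at h
          obtain ⟨rfl, rfl, rfl⟩ := h
          simp [cb, cl_cb_app, iht.1, k3]
        · simp only [cons.injEq] at h
          obtain ⟨rfl, rfl, rfl⟩ := h
          rw [cb_app, ← k1, ← k2, iht.1]
          simp [cb, add_assoc]
    refine ⟨?_, key⟩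
    obtain ⟨s, R, e⟩ := xi_head a t f
    obtain ⟨k1, k2⟩ := key _ _ _ e
    rw [e, cl_cb_cons, add_assoc, k1, k2, cl, if_neg (ly_pos a t f)]

end RF

open RF

/-- The composite `γ⁻¹ ∘ ξ ∘ γ` is a bijection of `Nor_n` onto itself (below:
a map `Φ` with `γ ∘ Φ = ξ ∘ γ` on `Nor_n`) which carries the Lyndon type to the
comb type, `λ^{Comb}(γ⁻¹ξγ(Υ)) = λ^{Lyn}(Υ)`, and preserves the left-to-right
sequence of leaf labels of each tree. -/
theorem gammaInv_xi_gamma_bijection (n : ℕ) (hn : 1 ≤ n) :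
    ∃ Φ : CTree → CTree,
      Set.BijOn Φ (NorSet n) (NorSet n) ∧
      (∀ T ∈ NorSet n, gammaMap (Φ T) = xiMap (gammaMap T)) ∧
      (∀ T ∈ NorSet n, CTree.combType (Φ T) = CTree.lynType T) ∧
      (∀ T ∈ NorSet n, CTree.leavesList (Φ T) = CTree.leavesList T) := by
  have hΦ : ∀ T ∈ NorSet n,
      toTree (CTree.leaf (CTree.minLeaf T)) (xi (toF T)) ∈ NorSet n ∧
      CTree.minLeaf (toTree (CTree.leaf (CTree.minLeaf T)) (xi (toF T))) = CTree.minLeaf T ∧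
      toF (toTree (CTree.leaf (CTree.minLeaf T)) (xi (toF T))) = xi (toF T) ∧
      CTree.leavesList (toTree (CTree.leaf (CTree.minLeaf T)) (xi (toF T)))
        = CTree.leavesList T := by
    rintro T ⟨h1, h2, h3⟩
    obtain ⟨k1, k2, k3⟩ := toF_spec T h2
    have hl : CTree.leavesList (toTree (CTree.leaf (CTree.minLeaf T)) (xi (toF T)))
        = CTree.leavesList T := by
      rw [leaves_toTree, k1, lv_xi]; rfl
    have hn : (CTree.leavesList T).Nodup :=
      h1.nodup_iff.2 (List.nodup_range.map (fun a b h => by simpa using h))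
    have hn' : (lv (toF T)).Nodup := by
      rw [k1] at hn
      exact (List.nodup_cons.1 hn).2
    have hI := Incr_xi _ k2 hn'
    obtain ⟨g1, g2⟩ := norm_toTree (xi (toF T)) (CTree.leaf (CTree.minLeaf T)) trivial hI
      (by simpa [CTree.minLeaf] using k3)
    refine ⟨⟨?_, g1, mono_toTree _ _ trivial⟩, g2, ?_, hl⟩
    · simpa only [CTree.OnSet, hl] using h1
    · rw [toF_toTree _ _ hI]; rfl
  refine ⟨fun T => toTree (CTree.leaf (CTree.minLeaf T)) (xi (toF T)), ⟨?_, ?_, ?_⟩, ?_, ?_, ?_⟩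
  · exact fun T hT => (hΦ T hT).1
  · intro T hT T' hT' h
    simp only at h
    obtain ⟨-, a1, a2, -⟩ := hΦ T hT
    obtain ⟨-, b1, b2, -⟩ := hΦ T' hT'
    rw [h] at a1 a2
    have e1 : CTree.minLeaf T = CTree.minLeaf T' := a1.symm.trans b1
    have e2 : toF T = toF T' :=
      xi_inj _ _ (toF_spec T hT.2.1).2.1 (toF_spec T' hT'.2.1).2.1 (a2.symm.trans b2)
    rw [← toTree_toF T hT.2.1 hT.2.2, ← toTree_toF T' hT'.2.1 hT'.2.2, e1, e2]
  · rintro T ⟨h1, h2, h3⟩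
    obtain ⟨k1, k2, k3⟩ := toF_spec T h2
    have hn : (CTree.leavesList T).Nodup :=
      h1.nodup_iff.2 (List.nodup_range.map (fun a b h => by simpa using h))
    have hn' : (lv (toF T)).Nodup := by
      rw [k1] at hn
      exact (List.nodup_cons.1 hn).2
    obtain ⟨F, hF, e⟩ := xi_surj _ (toF T) le_rfl k2 hn'
    rw [← e, lv_xi] at k1 k3
    obtain ⟨g1, g2⟩ := norm_toTree F (CTree.leaf (CTree.minLeaf T)) trivial hF
      (by simpa [CTree.minLeaf] using k3)
    refine ⟨toTree (CTree.leaf (CTree.minLeaf T)) F, ⟨?_, g1, mono_toTree _ _ trivial⟩, ?_⟩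
    · have hl : CTree.leavesList (toTree (CTree.leaf (CTree.minLeaf T)) F)
          = CTree.leavesList T := by
        rw [leaves_toTree, k1]; rfl
      simpa only [CTree.OnSet, hl] using h1
    · simp only
      rw [g2, toF_toTree _ _ hF]
      simp only [toF, app, CTree.minLeaf]
      rw [e, toTree_toF T h2 h3]
  · intro T hT
    obtain ⟨a0, a1, a2, -⟩ := hΦ T hT
    obtain ⟨h1, h2, h3⟩ := hT
    obtain ⟨k1, k2, k3⟩ := toF_spec T h2
    have hpos : ∀ x ∈ lv (toF T), 1 ≤ x := fun x hx => by
      have := k3 x hx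
      omega
    simp only
    rw [gammaMap_toF _ a0.2.1, a2, gammaMap_toF T h2, xiMap_wd _ (Incr_mp _ k2 hpos),
      xi_mp _ hpos]
  · intro T hT
    obtain ⟨a0, a1, a2, -⟩ := hΦ T hT
    rw [lynType_toF T hT.2.1 hT.2.2, ← (cb_xi_aux (toF T)).1, CTree.combType, combAux_toF, a2]
    rfl
  · exact fun T hT => (hΦ T hT).2.2.2
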